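/- Let δ > 0, M > 0, ε₀ > 0, and let F : ℝ × ℂ → ℂ be such that for every ε ∈ (0, ε₀] the map k ↦ F(ε,k) is complex-differentiable on the open ball {k : |k| < δ} and satisfies |F(ε,k)| ≤ M there. Then for every ε with 0 < ε < min(ε₀, δ/M) there exists a unique k in the closed ball {k : |k| ≤ δ/2} satisfying 2k = εF(ε,k), and this k satisfies |k| ≤ εM/2; in particular k → 0 as ε → 0. -/

import Mathlib

open Metric

/-- Existence and uniqueness of the small root of the reduced scalar equation (3.6),
`2k = εF(ε,k)`, for `F(ε,·)` holomorphic and uniformly bounded on a fixed disk. -/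
theorem reduced_equation_unique_root
    (δ M ε₀ : ℝ) (hδ : 0 < δ) (hM : 0 < M) (hε₀ : 0 < ε₀)
    (F : ℝ → ℂ → ℂ)
    (hF : ∀ ε : ℝ, ε ∈ Set.Ioc 0 ε₀ →
      DifferentiableOn ℂ (F ε) (ball (0 : ℂ) δ) ∧
      ∀ k ∈ ball (0 : ℂ) δ, ‖F ε k‖ ≤ M) :
    ∀ ε : ℝ, 0 < ε → ε < min ε₀ (δ / M) →
      (∃! k : ℂ, k ∈ closedBall (0 : ℂ) (δ / 2) ∧ 2 * k = (ε : ℂ) * F ε k) ∧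
      (∀ k : ℂ, k ∈ closedBall (0 : ℂ) (δ / 2) → 2 * k = (ε : ℂ) * F ε k →
        ‖k‖ ≤ ε * M / 2) := by
  intro ε hε hlt
  obtain ⟨hlt1, hlt2⟩ := lt_min_iff.1 hlt
  obtain ⟨hd, hb⟩ := hF ε ⟨hε, hlt1.le⟩
  have hεM : ε * M < δ := (lt_div_iff₀ hM).1 hlt2
  have hεM0 : 0 < ε * M := mul_pos hε hM
  set r : ℝ := (ε * M + δ) / 4 with hr
  have hr0 : 0 < r := by positivity
  have hr1 : r < δ / 2 := by rw [hr]; linarith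
  have hr2 : ε * M / 2 < r := by rw [hr]; linarith
  set g : ℂ → ℂ := fun k => (ε : ℂ) / 2 * F ε k with hg
  have hsub : closedBall (0 : ℂ) (δ / 2) ⊆ ball 0 δ := closedBall_subset_ball (by linarith)
  have hεn : ‖(ε : ℂ) / 2‖ = ε / 2 := by
    simp [abs_of_pos hε]
  have hgb : ∀ k ∈ ball (0 : ℂ) δ, ‖g k‖ ≤ ε * M / 2 := by
    intro k hk
    have := hb k hk
    simp only [hg, norm_mul, hεn]
    nlinarith
  have hgd : DifferentiableOn ℂ g (ball 0 δ) := hd.const_mul _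
  have hder : ∀ c ∈ closedBall (0 : ℂ) (δ / 2), ‖deriv g c‖ ≤ ε * M / 2 / r := by
    intro c hc
    have hcb : closedBall c r ⊆ ball 0 δ := by
      apply closedBall_subset_ball'
      have := mem_closedBall.1 hc
      linarith
    apply Complex.norm_deriv_le_of_forall_mem_sphere_norm_le hr0
    · apply DifferentiableOn.diffContOnCl
      exact hgd.mono (closure_ball_subset_closedBall.trans hcb)
    · intro z hz
      exact hgb z (hcb (sphere_subset_closedBall hz))
  have hK0 : 0 ≤ ε * M / 2 / r := by positivity
  have hK1 : ε * M / 2 / r < 1 := (div_lt_one hr0).2 hr2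
  have hlip : ∀ x ∈ closedBall (0 : ℂ) (δ / 2), ∀ y ∈ closedBall (0 : ℂ) (δ / 2),
      ‖g y - g x‖ ≤ ε * M / 2 / r * ‖y - x‖ := by
    intro x hx y hy
    exact (convex_closedBall (0 : ℂ) (δ / 2)).norm_image_sub_le_of_norm_deriv_le
      (fun z hz => (hgd z (hsub hz)).differentiableAt (isOpen_ball.mem_nhds (hsub hz)))
      hder hx hy
  have hmaps : Set.MapsTo g (closedBall (0 : ℂ) (δ / 2)) (closedBall (0 : ℂ) (δ / 2)) := by
    intro k hk
    rw [mem_closedBall_zero_iff]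
    have := hgb k (hsub hk)
    linarith
  have hiff : ∀ k : ℂ, 2 * k = (ε : ℂ) * F ε k ↔ g k = k := by
    intro k
    simp only [hg]
    constructor
    · intro h; linear_combination -h / 2
    · intro h; linear_combination -2 * h
  have hcon : ContractingWith ⟨ε * M / 2 / r, hK0⟩ (hmaps.restrict g _ _) := by
    refine ⟨by exact_mod_cast hK1, LipschitzWith.of_dist_le_mul ?_⟩
    intro x y
    have := hlip y y.2 x x.2
    rw [← dist_eq_norm, ← dist_eq_norm] at this
    exact this
  have h0 : (0 : ℂ) ∈ closedBall (0 : ℂ) (δ / 2) := mem_closedBall_self (by positivity)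
  obtain ⟨k, hk, hfix, -⟩ := ContractingWith.exists_fixedPoint'
    isClosed_closedBall.isComplete hmaps hcon h0 (edist_ne_top _ _)
  refine ⟨⟨k, ⟨hk, (hiff k).2 hfix⟩, ?_⟩, ?_⟩
  · rintro y ⟨hy, hye⟩
    have h1 := hlip k hk y hy
    rw [(hiff y).1 hye, hfix.eq] at h1
    have h2 : ‖y - k‖ ≤ 0 := by
      by_contra! h
      nlinarith
    exact sub_eq_zero.1 (norm_le_zero_iff.1 h2)
  · intro k hk hke
    have := hgb k (hsub hk)
    rwa [(hiff k).1 hke] at this
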